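/- Suppose there exist weights μ_i > 0 (1 ≤ i ≤ n) such that δ_i := 1 − Σ_{j≠i} (μ_j/μ_i) ρ |a_ji| − |1 − ρ a_ii| > 0 for every i, and set θ := min_{1≤i≤n} δ_i > 0. Define G_i(x) := clamp( x_i − ρ Σ_{j=1}^n a_ij x_j − ρ a_i ; c_{1,i}, c_{2,i} ) − x_i. Then for all x¹, x² ∈ R^n one has Σ_{i=1}^n μ_i sgn(x²_i − x¹_i) (G_i(x²) − G_i(x¹)) ≤ −θ Σ_{i=1}^n μ_i |x²_i − x¹_i|. (This is the Lyapunov decrease estimate from which the global Mittag-Leffler stability of the fractional-order projective dynamical system in Corollary 3.3 is deduced.) -/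

import Mathlib

noncomputable def clamp (s c d : ℝ) : ℝ := min (max s c) d

noncomputable def sgn (t : ℝ) : ℝ := if 0 < t then 1 else if t < 0 then -1 else 0

theorem abs_clamp_sub_clamp_le (s t c d : ℝ) : |clamp s c d - clamp t c d| ≤ |s - t| :=
  (abs_min_sub_min_le_max _ _ _ _).trans <| by
    simpa using abs_max_sub_max_le_abs s t c

theorem sgn_mul_sub_le (y z : ℝ) : sgn y * (z - y) ≤ |z| - |y| := by
  unfold sgn
  split_ifs with hpos hneg
  · rw [abs_of_pos hpos]
    linarith [le_abs_self z]
  · rw [abs_of_neg hneg]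
    linarith [neg_abs_le z]
  · obtain rfl : y = 0 := by linarith
    simp

theorem abs_sub_mul_sum_le {ι : Type*} [Fintype ι] [DecidableEq ι] {ρ : ℝ} (hρ : 0 ≤ ρ)
    (b y : ι → ℝ) (i : ι) :
    |y i - ρ * ∑ j, b j * y j| ≤
      |1 - ρ * b i| * |y i| + ∑ j ∈ Finset.univ.erase i, ρ * |b j| * |y j| := by
  have hsplit : y i - ρ * ∑ j, b j * y j =
      (1 - ρ * b i) * y i - ∑ j ∈ Finset.univ.erase i, ρ * b j * y j := by
    rw [← Finset.add_sum_erase _ _ (Finset.mem_univ i), mul_add, Finset.mul_sum]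
    simp only [mul_assoc]
    ring
  rw [hsplit]
  refine (abs_sub _ _).trans (add_le_add (abs_mul _ _).le ?_)
  refine (Finset.abs_sum_le_sum_abs _ _).trans (Finset.sum_le_sum fun j _ => ?_)
  rw [abs_mul, abs_mul, abs_of_nonneg hρ]

theorem sum_sum_erase_comm {ι : Type*} [Fintype ι] [DecidableEq ι] (f : ι → ι → ℝ) :
    ∑ i, ∑ j ∈ Finset.univ.erase i, f i j = ∑ i, ∑ j ∈ Finset.univ.erase i, f j i :=
  Finset.sum_comm' fun i j => by simp [ne_comm]

theorem stmt12
    (n : ℕ) (hn : 0 < n)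
    (ρ : ℝ) (hρ : 0 < ρ)
    (A : Fin n → Fin n → ℝ) (a : Fin n → ℝ)
    (c1 c2 : Fin n → ℝ) (hc : ∀ i, c1 i ≤ c2 i)
    (μ : Fin n → ℝ) (hμ : ∀ i, 0 < μ i)
    (δ : Fin n → ℝ)
    (hδdef : ∀ i, δ i = 1 - (∑ j ∈ Finset.univ.erase i, (μ j / μ i) * (ρ * |A j i|))
        - |1 - ρ * A i i|)
    (hδpos : ∀ i, 0 < δ i)
    (θ : ℝ) (hθ : IsLeast (Set.range δ) θ)
    (G : (Fin n → ℝ) → Fin n → ℝ)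
    (hG : ∀ x i, G x i = clamp (x i - ρ * (∑ j, A i j * x j) - ρ * a i) (c1 i) (c2 i) - x i)
    :
    0 < θ ∧
    ∀ (x1 x2 : Fin n → ℝ),
      (∑ i, μ i * sgn (x2 i - x1 i) * (G x2 i - G x1 i))
        ≤ -θ * ∑ i, μ i * |x2 i - x1 i| := by
  have hθpos : 0 < θ := by
    obtain ⟨i, rfl⟩ := hθ.1
    exact hδpos i
  refine ⟨hθpos, fun x1 x2 => ?_⟩
  have hterm : ∀ i, μ i * sgn (x2 i - x1 i) * (G x2 i - G x1 i) ≤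
      μ i * (|1 - ρ * A i i| - 1) * |x2 i - x1 i| +
        ∑ j ∈ Finset.univ.erase i, μ i * (ρ * |A i j|) * |x2 j - x1 j| := by
    intro i
    set z := clamp (x2 i - ρ * (∑ j, A i j * x2 j) - ρ * a i) (c1 i) (c2 i) -
      clamp (x1 i - ρ * (∑ j, A i j * x1 j) - ρ * a i) (c1 i) (c2 i) with hz
    have hG' : G x2 i - G x1 i = z - (x2 i - x1 i) := by
      rw [hG, hG, hz]
      ring
    have hzle : |z| ≤ |(x2 i - x1 i) - ρ * ∑ j, A i j * (x2 j - x1 j)| := by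
      refine (abs_clamp_sub_clamp_le _ _ _ _).trans (le_of_eq ?_)
      simp only [mul_sub, Finset.sum_sub_distrib]
      congr 1
      ring
    have hrow := abs_sub_mul_sum_le hρ.le (A i) (fun j => x2 j - x1 j) i
    have hsgn := sgn_mul_sub_le (x2 i - x1 i) z
    calc μ i * sgn (x2 i - x1 i) * (G x2 i - G x1 i)
        = μ i * (sgn (x2 i - x1 i) * (z - (x2 i - x1 i))) := by rw [hG', mul_assoc]
      _ ≤ μ i * (|1 - ρ * A i i| * |x2 i - x1 i| +
            ∑ j ∈ Finset.univ.erase i, ρ * |A i j| * |x2 j - x1 j| - |x2 i - x1 i|) :=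
          mul_le_mul_of_nonneg_left (by linarith) (hμ i).le
      _ = _ := by
          simp only [mul_assoc, ← Finset.mul_sum]
          ring
  have hcol : ∀ i, μ i * (|1 - ρ * A i i| - 1) * |x2 i - x1 i| +
      ∑ j ∈ Finset.univ.erase i, μ j * (ρ * |A j i|) * |x2 i - x1 i| =
        -(δ i * (μ i * |x2 i - x1 i|)) := by
    intro i
    have hsum : ∑ j ∈ Finset.univ.erase i, μ j * (ρ * |A j i|) =
        μ i * ∑ j ∈ Finset.univ.erase i, (μ j / μ i) * (ρ * |A j i|) := by
      rw [Finset.mul_sum]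
      refine Finset.sum_congr rfl fun j _ => ?_
      rw [← mul_assoc (μ i), mul_div_cancel₀ _ (hμ i).ne']
    rw [← Finset.sum_mul, hsum, hδdef]
    ring
  calc _ ≤ ∑ i, (μ i * (|1 - ρ * A i i| - 1) * |x2 i - x1 i| +
        ∑ j ∈ Finset.univ.erase i, μ i * (ρ * |A i j|) * |x2 j - x1 j|) :=
        Finset.sum_le_sum fun i _ => hterm i
    _ = ∑ i, -(δ i * (μ i * |x2 i - x1 i|)) := by
        rw [Finset.sum_add_distrib, sum_sum_erase_comm, ← Finset.sum_add_distrib]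
        exact Finset.sum_congr rfl fun i _ => hcol i
    _ ≤ ∑ i, -(θ * (μ i * |x2 i - x1 i|)) :=
        Finset.sum_le_sum fun i _ => neg_le_neg <|
          mul_le_mul_of_nonneg_right (hθ.2 ⟨i, rfl⟩) (mul_nonneg (hμ i).le (abs_nonneg _))
    _ = _ := by rw [Finset.sum_neg_distrib, ← Finset.mul_sum, neg_mul]
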